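/- For all 1 ≤ j < i ≤ n and all ε, ζ ∈ {1,−1}, the following commutation identities hold in H_{2,n}(q): 𝒯ᵢ^ε 𝒯ⱼ^ζ = 𝒯ⱼ^ζ 𝒯ᵢ^ε, τᵢ^ε τⱼ^ζ = τⱼ^ζ τᵢ^ε, and 𝒯ᵢ^ε τⱼ^ζ = τⱼ^ζ 𝒯ᵢ^ε. (Lemma 3, item (1).) -/

import Mathlib

noncomputable section

namespace MixedHecke

/-- The ring `ℤ[q,q⁻¹]` of Laurent polynomials over `ℤ`. -/
abbrev R : Type := LaurentPolynomial ℤ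

/-- The variable `q`. -/
def q : R := LaurentPolynomial.T 1

/-- The inverse `q⁻¹` of the variable `q`. -/
def qinv : R := LaurentPolynomial.T (-1)

/-- Generators of the mixed braid group `B_{2,n}`:
`Sum.inl true` is `𝒯`, `Sum.inl false` is `τ`, and `Sum.inr ⟨i, _⟩` is `σ_i` for `1 ≤ i ≤ n-1`. -/
def Gen (n : ℕ) : Type := Bool ⊕ {i : ℕ // 1 ≤ i ∧ i < n}

/-- The generator `𝒯` in the free group. -/
def fT (n : ℕ) : FreeGroup (Gen n) := FreeGroup.of (Sum.inl true)

/-- The generator `τ` in the free group. -/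
def ftau (n : ℕ) : FreeGroup (Gen n) := FreeGroup.of (Sum.inl false)

/-- The generator `σ_i` in the free group (junk value `1` for `i` out of range). -/
def fs (n i : ℕ) : FreeGroup (Gen n) :=
  if h : 1 ≤ i ∧ i < n then FreeGroup.of (Sum.inr ⟨i, h⟩) else 1

/-- The defining relators of the mixed braid group `B_{2,n}`. -/
def rels (n : ℕ) : Set (FreeGroup (Gen n)) :=
  { x | (∃ k j, 1 ≤ j ∧ j + 1 < k ∧ k < n ∧
          x = fs n k * fs n j * (fs n j * fs n k)⁻¹) ∨
        (∃ k, 1 ≤ k ∧ k + 1 < n ∧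
          x = fs n k * fs n (k+1) * fs n k * (fs n (k+1) * fs n k * fs n (k+1))⁻¹) ∨
        (∃ k, 2 ≤ k ∧ k < n ∧ x = fT n * fs n k * (fs n k * fT n)⁻¹) ∨
        (∃ k, 2 ≤ k ∧ k < n ∧ x = ftau n * fs n k * (fs n k * ftau n)⁻¹) ∨
        (1 < n ∧ x = fT n * fs n 1 * fT n * fs n 1 * (fs n 1 * fT n * fs n 1 * fT n)⁻¹) ∨
        (1 < n ∧ x = ftau n * fs n 1 * ftau n * fs n 1 * (fs n 1 * ftau n * fs n 1 * ftau n)⁻¹) ∨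
        (1 < n ∧ x = ftau n * (fs n 1 * fT n * fs n 1) * ((fs n 1 * fT n * fs n 1) * ftau n)⁻¹) }

/-- The mixed braid group `B_{2,n}` on two fixed strands. -/
abbrev B (n : ℕ) : Type := PresentedGroup (rels n)

/-- The group algebra `ℤ[q,q⁻¹] B_{2,n}`. -/
abbrev GA (n : ℕ) : Type := MonoidAlgebra R (B n)

/-- The image of `σ_i` in the group algebra. -/
def gA (n i : ℕ) : GA n := MonoidAlgebra.of R (B n) (PresentedGroup.mk (rels n) (fs n i))

/-- The quadratic relations `σ_i² = (q-1)σ_i + q·1`, `i = 1, …, n-1`. -/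
inductive quadRel (n : ℕ) : GA n → GA n → Prop
  | intro (i : ℕ) (h1 : 1 ≤ i) (h2 : i < n) :
      quadRel n (gA n i * gA n i) ((q - 1) • gA n i + q • (1 : GA n))

/-- The mixed Hecke algebra `H_{2,n}(q)`: the quotient of the group algebra `ℤ[q,q⁻¹] B_{2,n}`
by the two-sided ideal generated by the quadratic relations. -/
abbrev H (n : ℕ) : Type := RingQuot (quadRel n)

/-- The canonical monoid homomorphism `B_{2,n} →* H_{2,n}(q)`. -/
def π (n : ℕ) : B n →* H n :=
  (RingQuot.mkAlgHom R (quadRel n)).toMonoidHom.comp (MonoidAlgebra.of R (B n))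

/-- The canonical map from the free group on the generators to the units of `H_{2,n}(q)`
(images of group elements are units). -/
def U (n : ℕ) : FreeGroup (Gen n) →* (H n)ˣ :=
  ((π n).comp (PresentedGroup.mk (rels n))).toHomUnits

/-- The braiding generator `g_i` as a unit of `H_{2,n}(q)`. -/
def g (n i : ℕ) : (H n)ˣ := U n (fs n i)

/-- The word for the looping element `𝒯_i` : `𝒯_1 = 𝒯` and `𝒯_{i+1} = σ_i 𝒯_i σ_i`,
i.e. `𝒯_i = σ_{i-1} ⋯ σ_1 𝒯 σ_1 ⋯ σ_{i-1}`. -/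
def wT (n : ℕ) : ℕ → FreeGroup (Gen n)
  | 0 => 1
  | 1 => fT n
  | (i+2) => fs n (i+1) * wT n (i+1) * fs n (i+1)

/-- The word for the looping element `τ_i` : `τ_1 = τ` and `τ_{i+1} = σ_i τ_i σ_i`,
i.e. `τ_i = σ_{i-1} ⋯ σ_1 τ σ_1 ⋯ σ_{i-1}`. -/
def wtau (n : ℕ) : ℕ → FreeGroup (Gen n)
  | 0 => 1
  | 1 => ftau n
  | (i+2) => fs n (i+1) * wtau n (i+1) * fs n (i+1)

/-- The looping element `𝒯_i` as a unit of `H_{2,n}(q)`. -/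
def T (n i : ℕ) : (H n)ˣ := U n (wT n i)

/-- The looping element `τ_i` as a unit of `H_{2,n}(q)`. -/
def tau (n i : ℕ) : (H n)ˣ := U n (wtau n i)

/-- The loopings of index `i` : `𝒯_i, τ_i, 𝒯_i⁻¹, τ_i⁻¹`, as units of `H_{2,n}(q)`. -/
def LoopU (n i : ℕ) : Set (H n)ˣ := {T n i, tau n i, (T n i)⁻¹, (tau n i)⁻¹}

/-- The braiding generators `g_i`, `1 ≤ i ≤ n-1`, as elements of `H_{2,n}(q)`. -/
def BraidGens (n : ℕ) : Set (H n) := {x | ∃ i, 1 ≤ i ∧ i < n ∧ x = (g n i : H n)}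

/-- The elements `g_i^{±1}` with `lo ≤ i ≤ hi - 1`, as elements of `H_{2,n}(q)`. -/
def BraidPM (n lo hi : ℕ) : Set (H n) :=
  {x | ∃ i, lo ≤ i ∧ i < hi ∧ (x = (g n i : H n) ∨ x = ((g n i)⁻¹ : (H n)ˣ))}


/-- If `s` satisfies the braid relations below `n` and `A (i + 1) = s i * A i * s i`, then `A i`
commutes with `s k` for `k + 1 < i`. -/
theorem commute_loop_of_lt {G : Type*} [Group G] {n : ℕ} {s A : ℕ → G}
    (far : ∀ k j, 1 ≤ j → j + 1 < k → k < n → Commute (s k) (s j))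
    (braid : ∀ k, 1 ≤ k → k + 1 < n → s k * s (k + 1) * s k = s (k + 1) * s k * s (k + 1))
    (hA : ∀ i, 1 ≤ i → A (i + 1) = s i * A i * s i)
    (above : ∀ k i, 1 ≤ i → i < k → k < n → Commute (A i) (s k))
    {k i : ℕ} (hk : 1 ≤ k) (hki : k + 2 ≤ i) (hi : i ≤ n) : Commute (A i) (s k) := by
  induction i, hki using Nat.le_induction with
  | base =>
    have hb := braid k hk (by omega)
    have hc := (above (k + 1) k hk (by omega) (by omega)).eq
    rw [hA (k + 1) (by omega), hA k hk]
    calc s (k + 1) * (s k * A k * s k) * s (k + 1) * s k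
        = s (k + 1) * s k * A k * (s k * s (k + 1) * s k) := by simp only [mul_assoc]
      _ = s (k + 1) * s k * (A k * s (k + 1)) * s k * s (k + 1) := by
        rw [hb]; simp only [mul_assoc]
      _ = (s (k + 1) * s k * s (k + 1)) * A k * s k * s (k + 1) := by
        rw [hc]; simp only [mul_assoc]
      _ = s k * (s (k + 1) * (s k * A k * s k) * s (k + 1)) := by
        rw [← hb]; simp only [mul_assoc]
  | succ i hki ih =>
    rw [hA i (by omega)]
    have h := far i k hk (by omega) (by omega)
    exact (h.mul_left (ih (by omega))).mul_left h

/-- If `A 1` commutes with `s k` for `2 ≤ k`, then `A i` commutes with `s k` for `i < k`. -/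
theorem commute_loop_of_gt {G : Type*} [Group G] {n : ℕ} {s A : ℕ → G}
    (far : ∀ k j, 1 ≤ j → j + 1 < k → k < n → Commute (s k) (s j))
    (hA : ∀ i, 1 ≤ i → A (i + 1) = s i * A i * s i)
    (hA1 : ∀ k, 2 ≤ k → k < n → Commute (A 1) (s k))
    (k i : ℕ) (hi : 1 ≤ i) (hik : i < k) (hk : k < n) : Commute (A i) (s k) := by
  induction i, hi using Nat.le_induction with
  | base => exact hA1 k hik hk
  | succ i hi ih =>
    rw [hA i hi]
    have h := (far k i hi hik hk).symm
    exact (h.mul_left (ih (by omega))).mul_left h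

/-- Two families of loopings, with `A 2` commuting with `X 1`, satisfy: `A i` commutes with `X j`
for `j < i`. -/
theorem commute_loop_loop {G : Type*} [Group G] {n : ℕ} {s A X : ℕ → G}
    (far : ∀ k j, 1 ≤ j → j + 1 < k → k < n → Commute (s k) (s j))
    (braid : ∀ k, 1 ≤ k → k + 1 < n → s k * s (k + 1) * s k = s (k + 1) * s k * s (k + 1))
    (hA : ∀ i, 1 ≤ i → A (i + 1) = s i * A i * s i)
    (hX : ∀ i, 1 ≤ i → X (i + 1) = s i * X i * s i)
    (hA1 : ∀ k, 2 ≤ k → k < n → Commute (A 1) (s k))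
    (hX1 : ∀ k, 2 ≤ k → k < n → Commute (X 1) (s k))
    (hAX : 1 < n → Commute (s 1 * A 1 * s 1) (X 1))
    {i j : ℕ} (hj : 1 ≤ j) (hji : j < i) (hi : i ≤ n) : Commute (A i) (X j) := by
  induction j, hj using Nat.le_induction with
  | base =>
    induction i, hji using Nat.le_induction with
    | base => rw [hA 1 le_rfl]; exact hAX hi
    | succ i h2i ih =>
      rw [hA i (by omega)]
      have h := (hX1 i h2i hi).symm
      exact (h.mul_left (ih (by omega))).mul_left h
  | succ j hj ih =>
    rw [hX j hj]
    have h := commute_loop_of_lt far braid hA (commute_loop_of_gt far hA hA1) hj hji hi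
    exact (h.mul_right (ih (by omega))).mul_right h

theorem U_eq_of_mem_rels {n : ℕ} {x y : FreeGroup (Gen n)} (h : x * y⁻¹ ∈ rels n) :
    U n x = U n y := by
  ext
  exact congrArg (π n) (PresentedGroup.mk_eq_mk_of_mul_inv_mem h)

theorem commute_g_g (n k j : ℕ) (hj : 1 ≤ j) (hjk : j + 1 < k) (hk : k < n) :
    Commute (g n k) (g n j) := by
  simpa only [Commute, SemiconjBy, g, map_mul] using
    U_eq_of_mem_rels (n := n) (Or.inl ⟨k, j, hj, hjk, hk, rfl⟩)

theorem g_braid (n k : ℕ) (hk : 1 ≤ k) (hkn : k + 1 < n) :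
    g n k * g n (k + 1) * g n k = g n (k + 1) * g n k * g n (k + 1) := by
  simpa only [g, map_mul] using
    U_eq_of_mem_rels (n := n) (Or.inr <| Or.inl ⟨k, hk, hkn, rfl⟩)

theorem T_succ (n i : ℕ) (hi : 1 ≤ i) : T n (i + 1) = g n i * T n i * g n i := by
  obtain ⟨i, rfl⟩ := Nat.exists_eq_add_of_le' hi
  simp only [T, g, wT, map_mul]

theorem tau_succ (n i : ℕ) (hi : 1 ≤ i) : tau n (i + 1) = g n i * tau n i * g n i := by
  obtain ⟨i, rfl⟩ := Nat.exists_eq_add_of_le' hi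
  simp only [tau, g, wtau, map_mul]

theorem commute_T_one_g (n k : ℕ) (hk : 2 ≤ k) (hkn : k < n) : Commute (T n 1) (g n k) := by
  simpa only [Commute, SemiconjBy, g, T, wT, map_mul] using
    U_eq_of_mem_rels (n := n) (Or.inr <| Or.inr <| Or.inl ⟨k, hk, hkn, rfl⟩)

theorem commute_tau_one_g (n k : ℕ) (hk : 2 ≤ k) (hkn : k < n) : Commute (tau n 1) (g n k) := by
  simpa only [Commute, SemiconjBy, g, tau, wtau, map_mul] using
    U_eq_of_mem_rels (n := n) (Or.inr <| Or.inr <| Or.inr <| Or.inl ⟨k, hk, hkn, rfl⟩)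

theorem commute_T_two_T_one (n : ℕ) (hn : 1 < n) :
    Commute (g n 1 * T n 1 * g n 1) (T n 1) := by
  have h := U_eq_of_mem_rels (n := n)
    (Or.inr <| Or.inr <| Or.inr <| Or.inr <| Or.inl ⟨hn, rfl⟩)
  simp only [map_mul] at h
  simpa only [Commute, SemiconjBy, g, T, wT, mul_assoc] using h.symm

theorem commute_tau_two_tau_one (n : ℕ) (hn : 1 < n) :
    Commute (g n 1 * tau n 1 * g n 1) (tau n 1) := by
  have h := U_eq_of_mem_rels (n := n)
    (Or.inr <| Or.inr <| Or.inr <| Or.inr <| Or.inr <| Or.inl ⟨hn, rfl⟩)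
  simp only [map_mul] at h
  simpa only [Commute, SemiconjBy, g, tau, wtau, mul_assoc] using h.symm

theorem commute_T_two_tau_one (n : ℕ) (hn : 1 < n) :
    Commute (g n 1 * T n 1 * g n 1) (tau n 1) := by
  have h := U_eq_of_mem_rels (n := n)
    (Or.inr <| Or.inr <| Or.inr <| Or.inr <| Or.inr <| Or.inr ⟨hn, rfl⟩)
  simp only [map_mul] at h
  simpa only [Commute, SemiconjBy, g, T, wT, tau, wtau, mul_assoc] using h.symm

/-- **Lemma 3, item (1).** For `j < i`: `𝒯_i^ε 𝒯_j^ζ = 𝒯_j^ζ 𝒯_i^ε`,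
`τ_i^ε τ_j^ζ = τ_j^ζ τ_i^ε` and `𝒯_i^ε τ_j^ζ = τ_j^ζ 𝒯_i^ε`. -/
theorem lemma3_item1 (n : ℕ) (hn : 1 ≤ n) (i j : ℕ) (hj : 1 ≤ j) (hji : j < i) (hi : i ≤ n)
    (ε ζ : ℤ) (hε : ε = 1 ∨ ε = -1) (hζ : ζ = 1 ∨ ζ = -1) :
    ((T n i ^ ε : (H n)ˣ) : H n) * ((T n j ^ ζ : (H n)ˣ) : H n)
        = ((T n j ^ ζ : (H n)ˣ) : H n) * ((T n i ^ ε : (H n)ˣ) : H n) ∧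
    ((tau n i ^ ε : (H n)ˣ) : H n) * ((tau n j ^ ζ : (H n)ˣ) : H n)
        = ((tau n j ^ ζ : (H n)ˣ) : H n) * ((tau n i ^ ε : (H n)ˣ) : H n) ∧
    ((T n i ^ ε : (H n)ˣ) : H n) * ((tau n j ^ ζ : (H n)ˣ) : H n)
        = ((tau n j ^ ζ : (H n)ˣ) : H n) * ((T n i ^ ε : (H n)ˣ) : H n) := by
  have hTT := commute_loop_loop (commute_g_g n) (g_braid n) (T_succ n) (T_succ n)
    (commute_T_one_g n) (commute_T_one_g n) (commute_T_two_T_one n) hj hji hi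
  have htt := commute_loop_loop (commute_g_g n) (g_braid n) (tau_succ n) (tau_succ n)
    (commute_tau_one_g n) (commute_tau_one_g n) (commute_tau_two_tau_one n) hj hji hi
  have hTt := commute_loop_loop (commute_g_g n) (g_braid n) (T_succ n) (tau_succ n)
    (commute_T_one_g n) (commute_tau_one_g n) (commute_T_two_tau_one n) hj hji hi
  exact ⟨congrArg Units.val (hTT.zpow_zpow ε ζ).eq, congrArg Units.val (htt.zpow_zpow ε ζ).eq,
    congrArg Units.val (hTt.zpow_zpow ε ζ).eq⟩

end MixedHecke
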